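/- arXiv:2010.00830 — 4 statements merged into one kernel-verified Lean document; each statement's English description precedes it below -/
import Mathlib

section
/- Let S be a finite family of subsets of ℕ. For all numberings μ, ν₀, ν₁ of S: if μ ≤ ν₀ ⊕ ν₁, then there exist numberings μ₀ and μ₁ of S such that μ ≡ μ₀ ⊕ μ₁, μ₀ ≤ ν₀, and μ₁ ≤ ν₁. (Distributivity of the semilattice of numberings of a finite family.) -/
/-- Reducibility between numberings. -/
def Numbering.Reducible (ν μ : ℕ → Set ℕ) : Prop :=
  ∃ f : ℕ → ℕ, Computable f ∧ ∀ n, ν n = μ (f n)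

/-- Equivalence of numberings: mutual reducibility. -/
def Numbering.Equiv (ν μ : ℕ → Set ℕ) : Prop :=
  Numbering.Reducible ν μ ∧ Numbering.Reducible μ ν

/-- The join `ν ⊕ μ`, satisfying `(ν ⊕ μ)(2x) = ν x` and `(ν ⊕ μ)(2x+1) = μ x`. -/
def Numbering.join (ν μ : ℕ → Set ℕ) : ℕ → Set ℕ :=
  fun n => if n % 2 = 0 then ν (n / 2) else μ (n / 2)

namespace Numbering

theorem join_two_mul (ν μ : ℕ → Set ℕ) (n : ℕ) : join ν μ (2 * n) = ν n := by
  simp [join]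

theorem join_two_mul_add_one (ν μ : ℕ → Set ℕ) (n : ℕ) : join ν μ (2 * n + 1) = μ n := by
  have h₁ : (2 * n + 1) % 2 = 1 := by omega
  have h₂ : (2 * n + 1) / 2 = n := by omega
  simp [join, h₁, h₂]

theorem primrec_even : Primrec fun n : ℕ => decide (n % 2 = 0) :=
  (Primrec.eq.comp (Primrec.nat_mod.comp Primrec.id (Primrec.const 2)) (Primrec.const 0)).decide

theorem primrec_half : Primrec fun n : ℕ => n / 2 :=
  Primrec.nat_div.comp Primrec.id (Primrec.const 2)

theorem primrec_double : Primrec fun n : ℕ => 2 * n :=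
  Primrec.nat_mul.comp (Primrec.const 2) Primrec.id

/-- Case distinction on the parity of the argument. -/
def interleave (a b : ℕ → ℕ) (n : ℕ) : ℕ :=
  bif decide (n % 2 = 0) then a (n / 2) else b (n / 2)

theorem interleave_two_mul (a b : ℕ → ℕ) (n : ℕ) : interleave a b (2 * n) = a n := by
  simp [interleave]

theorem interleave_two_mul_add_one (a b : ℕ → ℕ) (n : ℕ) :
    interleave a b (2 * n + 1) = b n := by
  have h₁ : (2 * n + 1) % 2 = 1 := by omega
  have h₂ : (2 * n + 1) / 2 = n := by omega
  simp [interleave, h₁, h₂]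

theorem computable_interleave {a b : ℕ → ℕ} (ha : Computable a) (hb : Computable b) :
    Computable (interleave a b) :=
  Computable.cond primrec_even.to_comp (ha.comp primrec_half.to_comp)
    (hb.comp primrec_half.to_comp)

theorem comp_interleave (μ : ℕ → Set ℕ) (a b : ℕ → ℕ) :
    μ ∘ interleave a b = join (μ ∘ a) (μ ∘ b) := by
  funext n
  by_cases h : n % 2 = 0 <;> simp [interleave, join, h]

theorem computable_getD (L : List ℕ) (d : ℕ) : Computable fun n => L.getD n d :=
  ((Primrec.list_getD d).comp (Primrec.const L) Primrec.id).to_comp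

/-- A finite set of indices suffices to enumerate a finite family. -/
theorem exists_list_of_finite_range {μ : ℕ → Set ℕ} (h : (Set.range μ).Finite) :
    ∃ L : List ℕ, ∀ n, ∃ m ∈ L, μ m = μ n := by
  choose c hc using fun A : Set.range μ => A.2
  have : Fintype (Set.range μ) := h.fintype
  refine ⟨(Finset.univ : Finset (Set.range μ)).toList.map c, fun n => ?_⟩
  exact ⟨c ⟨μ n, n, rfl⟩, by simp, hc ⟨μ n, n, rfl⟩⟩

/-- If `μ` numbers a finite family and reduces to the numbering `ν` of the same family on the
computable set `p`, then some numbering `μ ∘ g` of the whole family, with `g` computable,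
reduces to `ν` and is above the restriction of `μ` to `p`. -/
theorem exists_numbering_of_reducible_on {μ ν : ℕ → Set ℕ} (hfin : (Set.range μ).Finite)
    (hν : Set.range ν = Set.range μ) {p : ℕ → Bool} (hp : Computable p)
    {q : ℕ → ℕ} (hq : Computable q) (hpq : ∀ n, p n = true → μ n = ν (q n)) :
    ∃ g : ℕ → ℕ, Computable g ∧ Set.range (μ ∘ g) = Set.range μ ∧ Reducible (μ ∘ g) ν ∧
      ∃ r : ℕ → ℕ, Computable r ∧ ∀ n, p n = true → μ (g (r n)) = μ n := by
  obtain ⟨L, hL⟩ := exists_list_of_finite_range hfin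
  have hex : ∀ n, ∃ m, ν m = μ n := fun n => by
    have : μ n ∈ Set.range ν := hν ▸ ⟨n, rfl⟩
    exact this
  choose c hc using hex
  refine ⟨interleave (fun n => L.getD n 0) (fun n => bif p n then n else 0),
    computable_interleave (computable_getD L 0)
      (Computable.cond hp Computable.id (Computable.const 0)), ?_, ?_, ?_⟩
  · refine (Set.range_comp_subset_range _ _).antisymm ?_
    rintro _ ⟨n, rfl⟩
    obtain ⟨m, hm, hmn⟩ := hL n
    obtain ⟨i, hi, rfl⟩ := List.mem_iff_getElem.1 hm
    refine ⟨2 * i, ?_⟩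
    rw [Function.comp_apply, interleave_two_mul, List.getD_eq_getElem _ _ hi, hmn]
  · refine ⟨interleave (fun n => (L.map c).getD n (c 0)) (fun n => bif p n then q n else c 0),
      computable_interleave (computable_getD _ _)
        (Computable.cond hp hq (Computable.const _)), fun n => ?_⟩
    change _ = (ν ∘ _) n
    rw [comp_interleave, comp_interleave]
    refine congrFun (congrArg₂ join (funext fun k => ?_) (funext fun k => ?_)) n
    · simp only [Function.comp_apply, List.getD_map, hc]
    · cases hk : p k <;> simp [hk, hc, hpq]
  · refine ⟨fun n => 2 * n + 1, (Primrec.succ.comp primrec_double).to_comp, fun n hn => ?_⟩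
    rw [interleave_two_mul_add_one, hn, cond_true]

end Numbering

/-- Distributivity for finite families: if `μ ≤ ν₀ ⊕ ν₁` (all numberings of a finite
family `S`), then `μ ≡ μ₀ ⊕ μ₁` for some numberings `μ₀ ≤ ν₀`, `μ₁ ≤ ν₁` of `S`. -/
theorem distributive_for_finite_family (S : Set (Set ℕ)) (hfin : S.Finite)
    (μ ν₀ ν₁ : ℕ → Set ℕ)
    (hμ : Set.range μ = S) (hν₀ : Set.range ν₀ = S) (hν₁ : Set.range ν₁ = S)
    (h : Numbering.Reducible μ (Numbering.join ν₀ ν₁)) :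
    ∃ μ₀ μ₁ : ℕ → Set ℕ, Set.range μ₀ = S ∧ Set.range μ₁ = S ∧
      Numbering.Equiv μ (Numbering.join μ₀ μ₁) ∧
      Numbering.Reducible μ₀ ν₀ ∧ Numbering.Reducible μ₁ ν₁ := by
  subst hμ
  obtain ⟨f, hf, hfμ⟩ := h
  have hp : Computable fun n => decide (f n % 2 = 0) := Numbering.primrec_even.to_comp.comp hf
  have hq : Computable fun n => f n / 2 := Numbering.primrec_half.to_comp.comp hf
  obtain ⟨g₀, hg₀, hS₀, hred₀, r₀, hr₀, hμ₀⟩ :=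
    Numbering.exists_numbering_of_reducible_on hfin hν₀ hp hq fun n hn => by
      rw [hfμ n, Numbering.join, if_pos (of_decide_eq_true hn)]
  obtain ⟨g₁, hg₁, hS₁, hred₁, r₁, hr₁, hμ₁⟩ :=
    Numbering.exists_numbering_of_reducible_on hfin hν₁ (Primrec.not.to_comp.comp hp) hq
      fun n hn => by
        have hodd : ¬ f n % 2 = 0 := by simpa using hn
        rw [hfμ n, Numbering.join, if_neg hodd]
  refine ⟨μ ∘ g₀, μ ∘ g₁, hS₀, hS₁, ⟨?_, ?_⟩, hred₀, hred₁⟩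
  · refine ⟨fun n => bif decide (f n % 2 = 0) then 2 * r₀ n else 2 * r₁ n + 1,
      Computable.cond hp (Numbering.primrec_double.to_comp.comp hr₀)
        (Computable.succ.comp (Numbering.primrec_double.to_comp.comp hr₁)), fun n => ?_⟩
    beta_reduce
    cases hn : decide (f n % 2 = 0)
    · rw [cond_false, Numbering.join_two_mul_add_one, Function.comp_apply, hμ₁ n (by rw [hn]; rfl)]
    · rw [cond_true, Numbering.join_two_mul, Function.comp_apply, hμ₀ n hn]
  · exact ⟨Numbering.interleave g₀ g₁, Numbering.computable_interleave hg₀ hg₁, fun n =>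
      (congrFun (Numbering.comp_interleave μ g₀ g₁) n).symm⟩
end

section
/- Let ζ, ξ₀, ξ₁ : ℕ → Set ℕ be arbitrary numberings (of possibly different families). If ζ ≤ ξ₀ ⊕ ξ₁, then at least one of the following holds: (1) ζ ≤ ξ₀; (2) ζ ≤ ξ₁; (3) there exist numberings ζ₀ and ζ₁ such that ζ₀ ≤ ξ₀, ζ₁ ≤ ξ₁, ζ₀ ≤ ζ, ζ₁ ≤ ζ, and ζ ≡ ζ₀ ⊕ ζ₁. -/
theorem Computable.ite_even {p f g : ℕ → ℕ} (hp : Computable p) (hf : Computable f)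
    (hg : Computable g) : Computable fun n => if p n % 2 = 0 then f n else g n := by
  have he : Primrec fun m : ℕ => decide (m % 2 = 0) :=
    (PrimrecPred.decide
      (Primrec.eq.comp (Primrec.nat_mod.comp Primrec.id (Primrec.const 2)) (Primrec.const 0)))
  refine (Computable.cond (he.to_comp.comp hp) hf hg).of_eq fun n => ?_
  by_cases h : p n % 2 = 0 <;> simp [h]

theorem Computable.nat_half {f : ℕ → ℕ} (hf : Computable f) : Computable fun n => f n / 2 :=
  (Primrec.nat_div.comp Primrec.id (Primrec.const 2)).to_comp.comp hf


/-- Decomposition lemma: if `ζ ≤ ξ₀ ⊕ ξ₁`, then `ζ ≤ ξ₀`, or `ζ ≤ ξ₁`, or there are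
numberings `ζ₀ ≤ ξ₀, ζ`, `ζ₁ ≤ ξ₁, ζ` with `ζ ≡ ζ₀ ⊕ ζ₁`. -/
theorem decomposition_lemma (ζ ξ₀ ξ₁ : ℕ → Set ℕ)
    (h : Numbering.Reducible ζ (Numbering.join ξ₀ ξ₁)) :
    Numbering.Reducible ζ ξ₀ ∨ Numbering.Reducible ζ ξ₁ ∨
      ∃ ζ₀ ζ₁ : ℕ → Set ℕ,
        Numbering.Reducible ζ₀ ξ₀ ∧ Numbering.Reducible ζ₁ ξ₁ ∧
        Numbering.Reducible ζ₀ ζ ∧ Numbering.Reducible ζ₁ ζ ∧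
        Numbering.Equiv ζ (Numbering.join ζ₀ ζ₁) := by
  obtain ⟨f, hf, hζ⟩ := h
  have even_case : ∀ n, f n % 2 = 0 → ζ n = ξ₀ (f n / 2) := fun n hn => by
    rw [hζ, Numbering.join, if_pos hn]
  have odd_case : ∀ n, f n % 2 ≠ 0 → ζ n = ξ₁ (f n / 2) := fun n hn => by
    rw [hζ, Numbering.join, if_neg hn]
  by_cases hodd : ∀ n, f n % 2 ≠ 0
  · exact Or.inr (Or.inl ⟨_, hf.nat_half, fun n => odd_case n (hodd n)⟩)
  by_cases heven : ∀ n, f n % 2 = 0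
  · exact Or.inl ⟨_, hf.nat_half, fun n => even_case n (heven n)⟩
  push Not at hodd heven
  obtain ⟨a, ha⟩ := hodd
  obtain ⟨b, hb⟩ := heven
  let g₀ : ℕ → ℕ := fun n => if f n % 2 = 0 then n else a
  let g₁ : ℕ → ℕ := fun n => if f n % 2 = 0 then b else n
  have hg₀ : Computable g₀ := hf.ite_even Computable.id (Computable.const a)
  have hg₁ : Computable g₁ := hf.ite_even (Computable.const b) Computable.id
  have hfg₀ : ∀ n, f (g₀ n) % 2 = 0 := fun n => by
    by_cases h : f n % 2 = 0 <;> simp [g₀, h, ha]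
  have hfg₁ : ∀ n, f (g₁ n) % 2 ≠ 0 := fun n => by
    by_cases h : f n % 2 = 0
    · simpa only [g₁, if_pos h] using hb
    · simpa only [g₁, if_neg h] using h
  have hdouble : Computable fun n : ℕ => 2 * n :=
    (Primrec.nat_mul.comp (Primrec.const 2) Primrec.id).to_comp
  refine Or.inr (Or.inr ⟨ζ ∘ g₀, ζ ∘ g₁,
    ⟨_, (hf.comp hg₀).nat_half, fun n => even_case _ (hfg₀ n)⟩,
    ⟨_, (hf.comp hg₁).nat_half, fun n => odd_case _ (hfg₁ n)⟩,
    ⟨g₀, hg₀, fun _ => rfl⟩, ⟨g₁, hg₁, fun _ => rfl⟩,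
    ⟨_, hf.ite_even hdouble (Computable.succ.comp hdouble), fun n => ?_⟩,
    ⟨_, Computable.id.ite_even (hg₀.comp Computable.id.nat_half)
      (hg₁.comp Computable.id.nat_half), fun n => ?_⟩⟩)
  · by_cases h : f n % 2 = 0
    · simp [Numbering.join, g₀, h]
    · have h₁ : (2 * n + 1) % 2 ≠ 0 := by omega
      have h₂ : (2 * n + 1) / 2 = n := by omega
      simp only [if_neg h, Nat.succ_eq_add_one, Numbering.join, if_neg h₁, h₂, Function.comp_apply, g₁]
  · by_cases h : n % 2 = 0 <;> simp [Numbering.join, h]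
end

section
/- Let S be a finite family of subsets of ℕ containing at least two distinct elements. Then there exist infinitely many pairwise non-equivalent numberings of S; i.e., the quotient of the set of all numberings of S by the equivalence ≡ is infinite. -/
theorem Numbering.countable_setOf_reducible (μ : ℕ → Set ℕ) :
    {ν | Numbering.Reducible ν μ}.Countable := by
  have hcomp : {f : ℕ → ℕ | Computable f}.Countable :=
    Set.countable_coe_iff.1 (inferInstanceAs (Countable {f : ℕ → ℕ // Computable f}))
  refine (hcomp.image fun f n => μ (f n)).mono ?_
  rintro ν ⟨f, hf, h⟩
  exact ⟨f, hf, (funext h).symm⟩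

theorem Numbering.not_countable_setOf_range_eq {S : Set (Set ℕ)} (hS : S.Countable)
    (htwo : S.Nontrivial) : ¬ {ν : ℕ → Set ℕ | Set.range ν = S}.Countable := by
  obtain ⟨e, rfl⟩ := hS.exists_eq_range htwo.nonempty
  obtain ⟨_, ⟨a, rfl⟩, _, ⟨b, rfl⟩, hab⟩ := htwo
  let code (g : ℕ → Bool) (n : ℕ) : Set ℕ :=
    if Even n then e (n / 2) else if g (n / 2) then e a else e b
  have hrange (g : ℕ → Bool) : Set.range (code g) = Set.range e := by
    refine Set.Subset.antisymm ?_ ?_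
    · rintro _ ⟨n, rfl⟩
      dsimp only [code]
      split_ifs <;> exact Set.mem_range_self _
    · rintro _ ⟨n, rfl⟩
      exact ⟨2 * n, by simp [code]⟩
  have hinj : Function.Injective code := fun g g' h => by
    funext n
    have hn := congrFun h (2 * n + 1)
    have hdiv : (2 * n + 1) / 2 = n := by omega
    have hodd : ¬ Even (2 * n + 1) := by simp
    simp only [code, hdiv, if_neg hodd] at hn
    cases hg : g n <;> cases hg' : g' n <;> simp_all
  intro hcount
  have huniv : (Set.univ : Set (ℕ → Bool)).Countable :=
    (hcount.preimage hinj).mono fun g _ => hrange g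
  have : Countable (ℕ → Bool) := Set.countable_univ_iff.1 huniv
  obtain ⟨F, hF⟩ := exists_surjective_nat (ℕ → Bool)
  obtain ⟨n, hn⟩ := hF fun k => !F k k
  simpa using congrFun hn n

/-- A finite family `S` with at least two distinct elements has infinitely many
pairwise non-equivalent numberings: there is an injective (indeed pairwise
non-equivalent) sequence of numberings of `S`, so the quotient of the numberings
of `S` by `≡` is infinite. -/
theorem infinitely_many_numberings (S : Set (Set ℕ)) (hfin : S.Finite)
    (htwo : ∃ A ∈ S, ∃ B ∈ S, A ≠ B) :
    ∃ ν : ℕ → (ℕ → Set ℕ), (∀ i, Set.range (ν i) = S) ∧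
      ∀ i j, i ≠ j → ¬ Numbering.Equiv (ν i) (ν j) := by
  obtain ⟨ν, hν, hred⟩ := exists_seq_of_forall_finset_exists
    (fun ν : ℕ → Set ℕ => Set.range ν = S) (fun μ ν => ¬ Numbering.Reducible ν μ) fun s _ => by
      by_contra! h
      refine Numbering.not_countable_setOf_range_eq hfin.countable htwo ?_
      refine (s.countable_toSet.biUnion fun μ _ =>
        Numbering.countable_setOf_reducible μ).mono fun ν hν => ?_
      simpa using h ν hν
  refine ⟨ν, hν, fun i j hij hequiv => ?_⟩
  rcases hij.lt_or_gt with hlt | hgt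
  · exact hred i j hlt hequiv.2
  · exact hred j i hgt hequiv.1
end

section
/- Let S be an infinite countable family of subsets of ℕ, and let B, C ∈ S with B ≠ C. Let α and β be numberings of S such that β is minimal (every numbering ξ of S with ξ ≤ β satisfies β ≤ ξ) and β ≰ α. Let γ be a numbering whose range is exactly {B, C} and such that γ ≰ β. Put μ := γ ⊕ β, ν₀ := α ⊕ γ, and ν₁ := β. Then: μ, ν₀, ν₁ are numberings of S; μ ≤ ν₀ ⊕ ν₁; μ ≰ ν₀; μ ≰ ν₁; and there do not exist numberings μ₀ and μ₁ of S with μ ≡ μ₀ ⊕ μ₁, μ₀ ≤ ν₀, and μ₁ ≤ ν₁. In particular, the preorder of numberings of S modulo ≡ is not weakly distributive. -/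
namespace Numbering

theorem Reducible.trans {ν μ ξ : ℕ → Set ℕ} (h₁ : Reducible ν μ) (h₂ : Reducible μ ξ) :
    Reducible ν ξ := by
  obtain ⟨f, hf, hfe⟩ := h₁
  obtain ⟨g, hg, hge⟩ := h₂
  exact ⟨fun n => g (f n), hg.comp hf, fun n => by rw [hfe, hge]⟩

theorem computable_two_mul : Computable fun n : ℕ => 2 * n :=
  (Primrec.nat_mul.comp (Primrec.const 2) Primrec.id).to_comp

theorem computable_div_two : Computable fun n : ℕ => n / 2 :=
  (Primrec.nat_div.comp Primrec.id (Primrec.const 2)).to_comp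

theorem computable_mod_two_beq (k : ℕ) : Computable fun n : ℕ => n % 2 == k :=
  (Primrec.beq.comp (Primrec.nat_mod.comp Primrec.id (Primrec.const 2)) (Primrec.const k)).to_comp

theorem reducible_join_left (ν μ : ℕ → Set ℕ) : Reducible ν (join ν μ) :=
  ⟨fun n => 2 * n, computable_two_mul, fun n => (join_two_mul ν μ n).symm⟩

theorem reducible_join_right (ν μ : ℕ → Set ℕ) : Reducible μ (join ν μ) :=
  ⟨fun n => 2 * n + 1, Computable.succ.comp computable_two_mul,
    fun n => (join_two_mul_add_one ν μ n).symm⟩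

theorem Reducible.join_le {ν μ ξ : ℕ → Set ℕ} (h₁ : Reducible ν ξ) (h₂ : Reducible μ ξ) :
    Reducible (join ν μ) ξ := by
  obtain ⟨f, hf, hfe⟩ := h₁
  obtain ⟨g, hg, hge⟩ := h₂
  refine ⟨fun n => bif n % 2 == 0 then f (n / 2) else g (n / 2),
    Computable.cond (computable_mod_two_beq 0) (hf.comp computable_div_two)
      (hg.comp computable_div_two), fun n => ?_⟩
  rcases Nat.mod_two_eq_zero_or_one n with h | h <;> simp [join, h, hfe, hge]

theorem range_join (ν μ : ℕ → Set ℕ) :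
    Set.range (join ν μ) = Set.range ν ∪ Set.range μ := by
  apply Set.Subset.antisymm
  · rintro _ ⟨n, rfl⟩
    by_cases h : n % 2 = 0 <;> simp [join, h]
  · rintro _ (⟨n, rfl⟩ | ⟨n, rfl⟩)
    · exact ⟨2 * n, join_two_mul ν μ n⟩
    · exact ⟨2 * n + 1, join_two_mul_add_one ν μ n⟩

/-- The map sending `0` to `b`, `1` to `c`, and `n + 2` to `h n` if `p n` holds and to `b`
otherwise. -/
def patch (p : ℕ → Bool) (h : ℕ → ℕ) (b c : ℕ) : ℕ → ℕ
  | 0 => b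
  | 1 => c
  | n + 2 => bif p n then h n else b

theorem computable_patch {p : ℕ → Bool} {h : ℕ → ℕ} (hp : Computable p) (hh : Computable h)
    (b c : ℕ) : Computable (patch p h b c) := by
  have hsub : Computable fun n : ℕ => n - 2 :=
    (Primrec.nat_sub.comp Primrec.id (Primrec.const 2)).to_comp
  have heq (k : ℕ) : Computable fun n : ℕ => n == k :=
    (Primrec.beq.comp Primrec.id (Primrec.const k)).to_comp
  refine (Computable.cond (heq 0) (Computable.const b)
    (Computable.cond (heq 1) (Computable.const c)
      (Computable.cond (hp.comp hsub) (hh.comp hsub) (Computable.const b)))).of_eq ?_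
  rintro (_ | _ | n) <;> simp [patch]

/-- If `β` is minimal and a numbering `η` of `S` reduces both to `β` and to a numbering `ζ` of `S`
on a decidable set off which it only takes the values `B` and `C`, then `β` reduces to `ζ`. -/
theorem reducible_of_minimal_of_partial {S : Set (Set ℕ)} {B C : Set ℕ} (hB : B ∈ S) (hC : C ∈ S)
    {β η ζ : ℕ → Set ℕ} (hβ : Set.range β = S)
    (hβmin : ∀ ξ : ℕ → Set ℕ, Set.range ξ = S → Reducible ξ β → Reducible β ξ)
    (hη : Set.range η = S) (hζ : Set.range ζ = S)
    {p : ℕ → Bool} {h k : ℕ → ℕ} (hp : Computable p) (hh : Computable h) (hk : Computable k)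
    (hηβ : ∀ n, p n = true → η n = β (h n)) (hηζ : ∀ n, p n = true → η n = ζ (k n))
    (hηBC : ∀ n, p n = false → η n = B ∨ η n = C) : Reducible β ζ := by
  obtain ⟨b, hb⟩ : B ∈ Set.range β := hβ ▸ hB
  obtain ⟨c, hc⟩ : C ∈ Set.range β := hβ ▸ hC
  obtain ⟨b', hb'⟩ : B ∈ Set.range ζ := hζ ▸ hB
  obtain ⟨c', hc'⟩ : C ∈ Set.range ζ := hζ ▸ hC
  have hξ : Set.range (fun n => β (patch p h b c n)) = S := by
    apply Set.Subset.antisymm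
    · rintro _ ⟨n, rfl⟩
      exact hβ ▸ Set.mem_range_self _
    · intro X hX
      obtain ⟨n, rfl⟩ : X ∈ Set.range η := hη ▸ hX
      cases hn : p n with
      | true => exact ⟨n + 2, by simp [patch, hn, hηβ n hn]⟩
      | false =>
        rcases hηBC n hn with h' | h'
        · exact ⟨0, by simp [patch, h', hb]⟩
        · exact ⟨1, by simp [patch, h', hc]⟩
  refine (hβmin _ hξ ⟨_, computable_patch hp hh b c, fun _ => rfl⟩).trans
    ⟨_, computable_patch hp hk b' c', ?_⟩
  rintro (_ | _ | n)
  · simp [patch, hb, hb']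
  · simp [patch, hc, hc']
  · cases hn : p n with
    | true => simp [patch, hn, ← hηβ n hn, ← hηζ n hn]
    | false => simp [patch, hn, hb, hb']

end Numbering

/-- Failure of weak distributivity for infinite families: with `S` infinite countable,
`B ≠ C` in `S`, `α, β` numberings of `S`, `β` minimal with `β ≰ α`, and `γ` a numbering
of `{B, C}` with `γ ≰ β`, set `μ := γ ⊕ β`, `ν₀ := α ⊕ γ`, `ν₁ := β`.  Then `μ, ν₀, ν₁`
are numberings of `S`, `μ ≤ ν₀ ⊕ ν₁`, `μ ≰ ν₀`, `μ ≰ ν₁`, and there are no numberings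
`μ₀, μ₁` of `S` with `μ ≡ μ₀ ⊕ μ₁`, `μ₀ ≤ ν₀`, `μ₁ ≤ ν₁`. -/
theorem not_weakly_distributive (S : Set (Set ℕ))
    (hcount : S.Countable) (hinf : S.Infinite)
    (B C : Set ℕ) (hB : B ∈ S) (hC : C ∈ S) (hBC : B ≠ C)
    (α β : ℕ → Set ℕ) (hα : Set.range α = S) (hβ : Set.range β = S)
    (hβmin : ∀ ξ : ℕ → Set ℕ, Set.range ξ = S →
      Numbering.Reducible ξ β → Numbering.Reducible β ξ)
    (hβα : ¬ Numbering.Reducible β α)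
    (γ : ℕ → Set ℕ) (hγ : Set.range γ = {B, C})
    (hγβ : ¬ Numbering.Reducible γ β) :
    Set.range (Numbering.join γ β) = S ∧
    Set.range (Numbering.join α γ) = S ∧
    Set.range β = S ∧
    Numbering.Reducible (Numbering.join γ β)
      (Numbering.join (Numbering.join α γ) β) ∧
    ¬ Numbering.Reducible (Numbering.join γ β) (Numbering.join α γ) ∧
    ¬ Numbering.Reducible (Numbering.join γ β) β ∧
    ¬ ∃ μ₀ μ₁ : ℕ → Set ℕ, Set.range μ₀ = S ∧ Set.range μ₁ = S ∧
        Numbering.Equiv (Numbering.join γ β) (Numbering.join μ₀ μ₁) ∧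
        Numbering.Reducible μ₀ (Numbering.join α γ) ∧
        Numbering.Reducible μ₁ β := by
  have hγmem (n : ℕ) : γ n = B ∨ γ n = C := by
    have : γ n ∈ ({B, C} : Set (Set ℕ)) := hγ ▸ Set.mem_range_self n
    simpa using this
  have hsub : ({B, C} : Set (Set ℕ)) ⊆ S := by
    rintro X (rfl | rfl)
    exacts [hB, hC]
  have hβν : ¬ Numbering.Reducible β (Numbering.join α γ) := by
    rintro ⟨f, hf, hfe⟩
    refine hβα (Numbering.reducible_of_minimal_of_partial hB hC hβ hβmin hβ hα
      ((Numbering.computable_mod_two_beq 0).comp hf) Computable.id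
      (Numbering.computable_div_two.comp hf) (fun _ _ => rfl) (fun n hn => ?_) (fun n hn => ?_))
    · have hn : f n % 2 = 0 := by simpa using hn
      simp [hfe n, Numbering.join, hn]
    · have hn : f n % 2 = 1 := by simpa using hn
      simpa [hfe n, Numbering.join, hn] using hγmem (f n / 2)
  have hleft := Numbering.reducible_join_left γ β
  have hright := Numbering.reducible_join_right γ β
  refine ⟨?_, ?_, hβ, ?_, fun h => hβν (hright.trans h), fun h => hγβ (hleft.trans h), ?_⟩
  · rw [Numbering.range_join, hγ, hβ, Set.union_eq_self_of_subset_left hsub]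
  · rw [Numbering.range_join, hγ, hα, Set.union_eq_self_of_subset_right hsub]
  · exact ((Numbering.reducible_join_right α γ).trans
      (Numbering.reducible_join_left _ β)).join_le (Numbering.reducible_join_right _ β)
  · rintro ⟨μ₀, μ₁, hμ₀, -, ⟨-, hle⟩, hμ₀ν, -⟩
    obtain ⟨f, hf, hfe⟩ := (Numbering.reducible_join_left μ₀ μ₁).trans hle
    refine hβν (Numbering.Reducible.trans ?_ hμ₀ν)
    refine Numbering.reducible_of_minimal_of_partial hB hC hβ hβmin hμ₀ hμ₀
      ((Numbering.computable_mod_two_beq 1).comp hf)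
      (Numbering.computable_div_two.comp hf) Computable.id (fun n hn => ?_) (fun _ _ => rfl)
      (fun n hn => ?_)
    · have hn : f n % 2 = 1 := by simpa using hn
      simp [hfe n, Numbering.join, hn]
    · have hn : f n % 2 = 0 := by simpa using hn
      simpa [hfe n, Numbering.join, hn] using hγmem (f n / 2)
end
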